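/- arXiv:2106.05052 — 8 statements merged into one kernel-verified Lean document; each statement's English description precedes it below -/
import Mathlib

section
/- Let L be a choice logic and let m ∈ ℕ∪{∞} be obtainable in L. Then there exists an L-formula F such that deg(I,F) = m for every interpretation I. -/
open scoped Classical

structure ChoiceLogic where
  Conn : Type
  connFinite : Finite Conn
  optConn : Conn → ℕ → ℕ → ℕ
  degConn : Conn → ℕ → ℕ → ℕ∞ → ℕ∞ → ℕ∞
  optConn_le : ∀ c k l, optConn c k l ≤ (k + 1) * (l + 1)
  degConn_le : ∀ c k l m n,
    degConn c k l m n ≤ (optConn c k l : ℕ∞) ∨ degConn c k l m n = ⊤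

inductive Formula (L : ChoiceLogic) : Type
  | var : ℕ → Formula L
  | neg : Formula L → Formula L
  | and : Formula L → Formula L → Formula L
  | or : Formula L → Formula L → Formula L
  | choice : L.Conn → Formula L → Formula L → Formula L

namespace Formula

variable {L : ChoiceLogic}

/-- The optionality of a formula. -/
def opt : Formula L → ℕ
  | var _ => 1
  | neg _ => 1
  | and F G => max F.opt G.opt
  | or F G => max F.opt G.opt
  | choice c F G => L.optConn c F.opt G.opt

/-- The satisfaction degree of a formula under an interpretation `I ⊆ U` (with `⊤` as `∞`). -/
noncomputable def deg (I : Set ℕ) : Formula L → ℕ∞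
  | var a => if a ∈ I then 1 else ⊤
  | neg F => if deg I F = ⊤ then 1 else ⊤
  | and F G => max (deg I F) (deg I G)
  | or F G => min (deg I F) (deg I G)
  | choice c F G => L.degConn c F.opt G.opt (deg I F) (deg I G)

end Formula

/-- A degree `m` is obtainable in the choice logic `L`. -/
def Obtainable (L : ChoiceLogic) (m : ℕ∞) : Prop :=
  ∃ (I : Set ℕ) (F : Formula L), Formula.deg I F = m

namespace Formula

variable {L : ChoiceLogic}

/-- Replace each variable by a tautology or a contradiction of optionality `1`,
according to its truth value in `I`. -/
noncomputable def ground (I : Set ℕ) : Formula L → Formula L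
  | var a =>
    if a ∈ I then neg (and (var a) (neg (var a))) else and (var a) (neg (var a))
  | neg F => neg (ground I F)
  | and F G => and (ground I F) (ground I G)
  | or F G => or (ground I F) (ground I G)
  | choice c F G => choice c (ground I F) (ground I G)

theorem opt_ground (I : Set ℕ) (F : Formula L) : (ground I F).opt = F.opt := by
  induction F with
  | var a => by_cases h : a ∈ I <;> simp [ground, opt, h]
  | _ => simp_all [ground, opt]

theorem deg_ground (I J : Set ℕ) (F : Formula L) : deg J (ground I F) = deg I F := by
  induction F with
  | var a => by_cases h : a ∈ I <;> by_cases h' : a ∈ J <;> simp [ground, deg, h, h']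
  | _ => simp_all [ground, deg, opt_ground]

end Formula

/-- If `m` is obtainable in `L`, then there is an `L`-formula which is satisfied
to degree exactly `m` by every interpretation. -/
theorem exists_constant_degree_formula (L : ChoiceLogic) (m : ℕ∞)
    (h : Obtainable L m) :
    ∃ F : Formula L, ∀ I : Set ℕ, Formula.deg I F = m := by
  obtain ⟨I, F, rfl⟩ := h
  exact ⟨F.ground I, fun J => Formula.deg_ground I J F⟩
end

section
/- For every choice logic L and all L-formulas A, B: A and B are fully equivalent if and only if for every L-formula F and every formula F[A/B] obtained from F by replacing one occurrence of A in F by B, the formulas F and F[A/B] are fully equivalent. -/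
open scoped Classical

namespace Formula

variable {L : ChoiceLogic}

/-- `A` and `B` are degree-equivalent. -/
def DegreeEquiv (A B : Formula L) : Prop :=
  ∀ I : Set ℕ, Formula.deg I A = Formula.deg I B

end Formula

namespace Formula

variable {L : ChoiceLogic}

/-- `A` and `B` are fully equivalent. -/
def FullEquiv (A B : Formula L) : Prop :=
  Formula.DegreeEquiv A B ∧ A.opt = B.opt

end Formula

namespace Formula

variable {L : ChoiceLogic}

/-- `Subst A B F F'` holds iff `F'` is obtained from `F` by replacing one
occurrence of the subformula `A` in `F` by `B`. -/
inductive Subst (A B : Formula L) : Formula L → Formula L → Prop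
  | base : Subst A B A B
  | neg {F F'} : Subst A B F F' → Subst A B (Formula.neg F) (Formula.neg F')
  | andLeft {F F' G} : Subst A B F F' → Subst A B (Formula.and F G) (Formula.and F' G)
  | andRight {F G G'} : Subst A B G G' → Subst A B (Formula.and F G) (Formula.and F G')
  | orLeft {F F' G} : Subst A B F F' → Subst A B (Formula.or F G) (Formula.or F' G)
  | orRight {F G G'} : Subst A B G G' → Subst A B (Formula.or F G) (Formula.or F G')
  | choiceLeft {c F F' G} :
      Subst A B F F' → Subst A B (Formula.choice c F G) (Formula.choice c F' G)
  | choiceRight {c F G G'} :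
      Subst A B G G' → Subst A B (Formula.choice c F G) (Formula.choice c F G')

end Formula

theorem Formula.FullEquiv.of_subst {L : ChoiceLogic} {A B F F' : Formula L}
    (hAB : Formula.FullEquiv A B) (h : Formula.Subst A B F F') : Formula.FullEquiv F F' := by
  induction h with
  | base => exact hAB
  | neg _ ih => exact ⟨fun I => by simp only [Formula.deg, ih.1 I], rfl⟩
  | _ _ ih => exact ⟨fun I => by simp only [Formula.deg, ih.1 I, ih.2],
      by simp only [Formula.opt, ih.2]⟩

/-- `A` and `B` are fully equivalent iff `F` and `F[A/B]` are fully equivalent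
for every formula `F` and every replacement of one occurrence of `A` by `B`. -/
theorem fullEquiv_iff_subst_fullEquiv (L : ChoiceLogic) (A B : Formula L) :
    Formula.FullEquiv A B ↔
      ∀ F F' : Formula L, Formula.Subst A B F F' → Formula.FullEquiv F F' := by
  exact ⟨fun hAB _ _ h => hAB.of_subst h, fun h => h A B .base⟩
end

section
/- In CCL, ordered conjunction is associative: for all CCL-formulas F, G, H, opt((F⊙G)⊙H) = opt(F⊙(G⊙H)) and deg(I, (F⊙G)⊙H) = deg(I, F⊙(G⊙H)) for every interpretation I. -/
open scoped Classical

/-- CCL-formulas: classical connectives plus ordered conjunction `oc` (⊙). -/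
inductive CF : Type
  | var : ℕ → CF
  | neg : CF → CF
  | and : CF → CF → CF
  | or : CF → CF → CF
  | oc : CF → CF → CF

namespace CF

/-- Optionality of a CCL-formula. -/
def opt : CF → ℕ
  | var _ => 1
  | neg _ => 1
  | and F G => max F.opt G.opt
  | or F G => max F.opt G.opt
  | oc F G => F.opt + G.opt

/-- Satisfaction degree of a CCL-formula (with `⊤` as `∞`). -/
noncomputable def deg (I : Set ℕ) : CF → ℕ∞
  | var a => if a ∈ I then 1 else ⊤
  | neg F => if deg I F = ⊤ then 1 else ⊤
  | and F G => max (deg I F) (deg I G)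
  | or F G => min (deg I F) (deg I G)
  | oc F G =>
      if deg I F = 1 ∧ deg I G ≠ ⊤ then deg I G
      else if deg I F ≠ ⊤ ∧ (1 < deg I F ∨ deg I G = ⊤) then deg I F + (G.opt : ℕ∞)
      else ⊤

end CF

namespace CF

theorem one_le_opt : ∀ F : CF, 1 ≤ F.opt
  | var _ => le_rfl
  | neg _ => le_rfl
  | and F _ => le_max_of_le_left (one_le_opt F)
  | or F _ => le_max_of_le_left (one_le_opt F)
  | oc F _ => le_add_right (one_le_opt F)

theorem one_le_deg (I : Set ℕ) : ∀ F : CF, 1 ≤ deg I F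
  | var _ => by rw [deg]; split_ifs <;> simp
  | neg _ => by rw [deg]; split_ifs <;> simp
  | and F _ => le_max_of_le_left (one_le_deg I F)
  | or F G => le_min (one_le_deg I F) (one_le_deg I G)
  | oc F G => by
      rw [deg]
      split_ifs
      · exact one_le_deg I G
      · exact le_add_right (one_le_deg I F)
      · exact le_top

variable {I : Set ℕ} {F G : CF}

theorem deg_oc_congr_left {F' : CF} (h : deg I F = deg I F') :
    deg I (F.oc G) = deg I (F'.oc G) := by
  rw [deg, deg, h]

theorem deg_oc_of_eq_top (hF : deg I F = ⊤) : deg I (F.oc G) = ⊤ := by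
  simp [deg, hF]

theorem deg_oc_of_eq_one (hF : deg I F = 1) (hG : deg I G ≠ ⊤) :
    deg I (F.oc G) = deg I G := by
  simp [deg, hF, hG]

theorem deg_oc_of_eq_one_of_eq_top (hF : deg I F = 1) (hG : deg I G = ⊤) :
    deg I (F.oc G) = 1 + (G.opt : ℕ∞) := by
  simp [deg, hF, hG]

theorem deg_oc_of_one_lt (hF : 1 < deg I F) : deg I (F.oc G) = deg I F + (G.opt : ℕ∞) := by
  by_cases h : deg I F = ⊤ <;> simp [deg, hF, hF.ne', h]

theorem one_lt_add_opt {d : ℕ∞} (hd : 1 ≤ d) (G : CF) : 1 < d + (G.opt : ℕ∞) := by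
  have hG : (1 : ℕ∞) ≤ (G.opt : ℕ∞) := by exact_mod_cast one_le_opt G
  calc (1 : ℕ∞) < 1 + 1 := by norm_num
    _ ≤ d + (G.opt : ℕ∞) := add_le_add hd hG

theorem deg_oc_ne_top (hF : deg I F ≠ ⊤) : deg I (F.oc G) ≠ ⊤ := by
  rw [deg]
  split_ifs with h₁ h₂
  · exact h₁.2
  · exact WithTop.add_ne_top.2 ⟨hF, ENat.natCast_ne_top _⟩
  · have hF' : deg I F = 1 ∨ 1 < deg I F := (one_le_deg I F).eq_or_lt.imp_left Eq.symm
    tauto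

end CF

/-- Ordered conjunction in CCL is associative, both with respect to optionality
and with respect to satisfaction degrees. -/
theorem ccl_oc_assoc (F G H : CF) :
    ((F.oc G).oc H).opt = (F.oc (G.oc H)).opt ∧
      ∀ I : Set ℕ, CF.deg I ((F.oc G).oc H) = CF.deg I (F.oc (G.oc H)) := by
  refine ⟨Nat.add_assoc _ _ _, fun I => ?_⟩
  have hopt : ((G.oc H).opt : ℕ∞) = (G.opt : ℕ∞) + (H.opt : ℕ∞) := Nat.cast_add _ _
  rcases (CF.one_le_deg I F).eq_or_lt with hF | hF
  · by_cases hG : CF.deg I G = ⊤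
    · have hFG := CF.deg_oc_of_eq_one_of_eq_top hF.symm hG
      rw [CF.deg_oc_of_one_lt (hFG ▸ CF.one_lt_add_opt le_rfl G), hFG,
        CF.deg_oc_of_eq_one_of_eq_top hF.symm (CF.deg_oc_of_eq_top hG), hopt, add_assoc]
    · rw [CF.deg_oc_of_eq_one hF.symm (CF.deg_oc_ne_top hG),
        CF.deg_oc_congr_left (CF.deg_oc_of_eq_one hF.symm hG)]
  · have hFG := CF.deg_oc_of_one_lt (G := G) hF
    rw [CF.deg_oc_of_one_lt (hFG ▸ CF.one_lt_add_opt hF.le G), hFG,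
      CF.deg_oc_of_one_lt hF, hopt, add_assoc]
end

section
/- In QCL, ordered disjunction is associative: for all QCL-formulas F, G, H, opt((F⨯G)⨯H) = opt(F⨯(G⨯H)) and deg(I, (F⨯G)⨯H) = deg(I, F⨯(G⨯H)) for every interpretation I. -/
open scoped Classical

/-- QCL-formulas: classical connectives plus ordered disjunction `ord` (⨯). -/
inductive QF : Type
  | var : ℕ → QF
  | neg : QF → QF
  | and : QF → QF → QF
  | or : QF → QF → QF
  | ord : QF → QF → QF

namespace QF

/-- Optionality of a QCL-formula. -/
def opt : QF → ℕ
  | var _ => 1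
  | neg _ => 1
  | and F G => max F.opt G.opt
  | or F G => max F.opt G.opt
  | ord F G => F.opt + G.opt

/-- Satisfaction degree of a QCL-formula (with `⊤` as `∞`). -/
noncomputable def deg (I : Set ℕ) : QF → ℕ∞
  | var a => if a ∈ I then 1 else ⊤
  | neg F => if deg I F = ⊤ then 1 else ⊤
  | and F G => max (deg I F) (deg I G)
  | or F G => min (deg I F) (deg I G)
  | ord F G =>
      if deg I F ≠ ⊤ then deg I F
      else if deg I G ≠ ⊤ then deg I G + (F.opt : ℕ∞)
      else ⊤

end QF

/-- Ordered disjunction in QCL is associative, both with respect to optionality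
and with respect to satisfaction degrees. -/
theorem qcl_ord_assoc (F G H : QF) :
    ((F.ord G).ord H).opt = (F.ord (G.ord H)).opt ∧
      ∀ I : Set ℕ, QF.deg I ((F.ord G).ord H) = QF.deg I (F.ord (G.ord H)) := by
  refine ⟨Nat.add_assoc _ _ _, fun I => ?_⟩
  by_cases hF : QF.deg I F = ⊤ <;> by_cases hG : QF.deg I G = ⊤ <;>
    by_cases hH : QF.deg I H = ⊤ <;>
    simp [QF.deg, QF.opt, hF, hG, hH, add_assoc, add_comm (F.opt : ℕ∞)]
end

section
/- QCL is optionality-differentiating: for all QCL-formulas A and B with opt(A) ≠ opt(B) and any variable a not occurring in A or B, the formulas F = ((A ∧ ⊥) ⨯ a) and F' = ((B ∧ ⊥) ⨯ a) satisfy deg({a}, F) = opt(A)+1 and deg({a}, F') = opt(B)+1, so F and F' are not degree-equivalent. -/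
open scoped Classical

namespace QF

/-- Variables occurring in a QCL-formula. -/
def vars : QF → Set ℕ
  | var a => {a}
  | neg F => F.vars
  | and F G => F.vars ∪ G.vars
  | or F G => F.vars ∪ G.vars
  | ord F G => F.vars ∪ G.vars

end QF

namespace QF

theorem one_le_opt (F : QF) : 1 ≤ F.opt := by
  induction F <;> simp only [opt] <;> omega

theorem deg_var_and_neg_var (I : Set ℕ) (b : ℕ) :
    deg I ((var b).and (var b).neg) = ⊤ := by
  by_cases h : b ∈ I <;> simp [deg, h]

theorem deg_and_bot_ord_var {I : Set ℕ} {a : ℕ} (ha : a ∈ I) (F : QF) (b : ℕ) :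
    deg I ((F.and ((var b).and (var b).neg)).ord (var a)) = (F.opt : ℕ∞) + 1 := by
  have hdeg : deg I (F.and ((var b).and (var b).neg)) = ⊤ := by
    rw [deg, deg_var_and_neg_var, max_top_right]
  have hopt : (F.and ((var b).and (var b).neg)).opt = F.opt := by
    simp [opt, one_le_opt]
  rw [deg, hdeg, hopt]
  simp [deg, ha, add_comm]

end QF

/-- QCL is optionality-differentiating: for `A`, `B` with `opt(A) ≠ opt(B)`,
a fresh variable `a`, and `⊥ = (b ∧ ¬b)`, the formulas `F = ((A ∧ ⊥) ⨯ a)` and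
`F' = ((B ∧ ⊥) ⨯ a)` satisfy `deg({a},F) = opt(A)+1` and `deg({a},F') = opt(B)+1`,
hence `F` and `F'` are not degree-equivalent. -/
theorem qcl_optionality_differentiating (A B : QF) (hopt : A.opt ≠ B.opt)
    (a : ℕ) (ha : a ∉ A.vars ∪ B.vars) (b : ℕ) :
    QF.deg {a} ((A.and ((QF.var b).and (QF.var b).neg)).ord (QF.var a))
        = (A.opt : ℕ∞) + 1 ∧
      QF.deg {a} ((B.and ((QF.var b).and (QF.var b).neg)).ord (QF.var a))
        = (B.opt : ℕ∞) + 1 ∧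
      ¬ ∀ I : Set ℕ,
          QF.deg I ((A.and ((QF.var b).and (QF.var b).neg)).ord (QF.var a))
            = QF.deg I ((B.and ((QF.var b).and (QF.var b).neg)).ord (QF.var a)) := by
  have hA := QF.deg_and_bot_ord_var (Set.mem_singleton a) A b
  have hB := QF.deg_and_bot_ord_var (Set.mem_singleton a) B b
  refine ⟨hA, hB, fun h => hopt ?_⟩
  have hAB := h {a}
  rw [hA, hB] at hAB
  exact Nat.succ_injective (by exact_mod_cast hAB)
end

section
/- For every choice logic L and every L-formula F, opt(F) < 2^(|F|²), where |F| denotes the total number of variable occurrences in F. -/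
open scoped Classical

namespace Formula

variable {L : ChoiceLogic}

/-- The number of variable occurrences in a formula. -/
def size : Formula L → ℕ
  | var _ => 1
  | neg F => F.size
  | and F G => F.size + G.size
  | or F G => F.size + G.size
  | choice _ F G => F.size + G.size

end Formula

namespace Formula

theorem size_pos {L : ChoiceLogic} (F : Formula L) : 0 < F.size := by
  induction F <;> simp only [size] <;> omega

end Formula

/-- For every choice logic `L` and `L`-formula `F`, `opt(F) < 2 ^ (|F|²)`. -/
theorem opt_lt_two_pow_size_sq (L : ChoiceLogic) (F : Formula L) :
    F.opt < 2 ^ (F.size ^ 2) := by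
  induction F with
  | var a => simp [Formula.opt, Formula.size]
  | neg F _ =>
    exact Nat.one_lt_two_pow (pow_pos F.size_pos 2).ne'
  | and F G ihF ihG | or F G ihF ihG =>
    simp only [Formula.opt, Formula.size]
    refine max_lt (ihF.trans_le ?_) (ihG.trans_le ?_) <;> gcongr <;> omega
  | choice c F G ihF ihG =>
    simp only [Formula.opt, Formula.size]
    calc L.optConn c F.opt G.opt
        ≤ (F.opt + 1) * (G.opt + 1) := L.optConn_le c _ _
      _ ≤ 2 ^ F.size ^ 2 * 2 ^ G.size ^ 2 := Nat.mul_le_mul ihF ihG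
      _ = 2 ^ (F.size ^ 2 + G.size ^ 2) := (pow_add _ _ _).symm
      _ < 2 ^ (F.size + G.size) ^ 2 := by
        refine Nat.pow_lt_pow_right one_lt_two ?_
        nlinarith [Nat.mul_pos F.size_pos G.size_pos]
end

section
/- In LCL, let x_1, …, x_n be distinct propositional variables and let F_n = (x_1 ⋄ (x_2 ⋄ (⋯ (x_{n-1} ⋄ x_n)))). Then opt(F_n) = 2^n − 1, and for every 1 ≤ k ≤ 2^n, the lexicographically k-th largest interpretation I_k over x_1 > ⋯ > x_n satisfies deg(I_k, F_n) = k if k < 2^n and deg(I_k, F_n) = ∞ if k = 2^n. -/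
open scoped Classical

/-- LCL-formulas: classical connectives plus the connective `dia` (⋄). -/
inductive LF : Type
  | var : ℕ → LF
  | neg : LF → LF
  | and : LF → LF → LF
  | or : LF → LF → LF
  | dia : LF → LF → LF

namespace LF

/-- Optionality of an LCL-formula. -/
def opt : LF → ℕ
  | var _ => 1
  | neg _ => 1
  | and F G => max F.opt G.opt
  | or F G => max F.opt G.opt
  | dia F G => (F.opt + 1) * (G.opt + 1) - 1

/-- Satisfaction degree of an LCL-formula (with `⊤` as `∞`). -/
noncomputable def deg (I : Set ℕ) : LF → ℕ∞
  | var a => if a ∈ I then 1 else ⊤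
  | neg F => if deg I F = ⊤ then 1 else ⊤
  | and F G => max (deg I F) (deg I G)
  | or F G => min (deg I F) (deg I G)
  | dia F G =>
      if deg I F ≠ ⊤ ∧ deg I G ≠ ⊤ then (deg I F - 1) * (G.opt : ℕ∞) + deg I G
      else if deg I F ≠ ⊤ then (F.opt : ℕ∞) * (G.opt : ℕ∞) + deg I F
      else if deg I G ≠ ⊤ then
        (F.opt : ℕ∞) * (G.opt : ℕ∞) + (F.opt : ℕ∞) + deg I G
      else ⊤

end LF

/-- The right-nested formula `x 0 ⋄ (x 1 ⋄ (⋯ ⋄ x n))`. -/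
def lchain : (ℕ → ℕ) → ℕ → LF
  | x, 0 => LF.var (x 0)
  | x, n + 1 => (LF.var (x 0)).dia (lchain (fun j => x (j + 1)) n)

theorem opt_lchain (n : ℕ) (x : ℕ → ℕ) : (lchain x n).opt = 2 ^ (n + 1) - 1 := by
  induction n generalizing x with
  | zero => rfl
  | succ n ih =>
    have := Nat.one_le_two_pow (n := n + 1)
    simp only [lchain, LF.opt, ih, pow_succ 2 (n + 1)]
    omega

/-- If the bits of `v < 2 ^ (n + 1)` list, most significant first, which of `x 0, …, x n` lie
in `I`, then the chain has degree `2 ^ (n + 1) - v`, or `⊤` when `v = 0`. -/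
theorem deg_lchain (I : Set ℕ) (n : ℕ) (x : ℕ → ℕ) (v : ℕ) (hv : v < 2 ^ (n + 1))
    (hI : ∀ i ≤ n, x i ∈ I ↔ v.testBit (n - i) = true) :
    LF.deg I (lchain x n) = if v = 0 then ⊤ else ((2 ^ (n + 1) - v : ℕ) : ℕ∞) := by
  induction n generalizing x v with
  | zero =>
    have h := hI 0 le_rfl
    obtain rfl | rfl : v = 0 ∨ v = 1 := by omega
    · simp_all [lchain, LF.deg]
    · simp_all [lchain, LF.deg]
  | succ n ih =>
    have hpos := Nat.one_le_two_pow (n := n + 1)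
    have hpow : 2 ^ (n + 1 + 1) = 2 * 2 ^ (n + 1) := by ring
    have htail := ih (fun j => x (j + 1)) (v % 2 ^ (n + 1)) (Nat.mod_lt _ (by positivity)) (by
      intro i hi
      rw [hI (i + 1) (by omega), Nat.testBit_mod_two_pow, Nat.add_sub_add_right]
      simp [show n - i < n + 1 by omega])
    have hhead : x 0 ∈ I ↔ 2 ^ (n + 1) ≤ v := by
      rw [hI 0 (by omega), Nat.sub_zero]
      refine ⟨Nat.ge_two_pow_of_testBit, fun h => ?_⟩
      rw [Nat.testBit_eq_decide_div_mod_eq, Nat.div_eq_of_lt_le (k := 1) (by omega) (by omega)]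
      rfl
    simp only [lchain, LF.deg, htail, opt_lchain, LF.opt, hhead]
    rw [hpow] at hv ⊢
    generalize 2 ^ (n + 1) = p at *
    by_cases hp : p ≤ v
    · have hmod : v % p = v - p := by
        rw [Nat.mod_eq_sub_mod hp, Nat.mod_eq_of_lt (by omega)]
      by_cases h0 : v - p = 0
      · simp only [hp, hmod, h0, show v ≠ 0 by omega, if_true, if_false]
        simp only [ne_eq, ENat.one_ne_top, not_false_eq_true, not_true_eq_false, and_false,
          if_true, if_false]
        norm_cast
        omega
      · simp only [hp, hmod, h0, show v ≠ 0 by omega, if_true, if_false]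
        simp only [ne_eq, ENat.one_ne_top, ENat.natCast_ne_top, not_false_eq_true, and_self,
          if_true, tsub_self, zero_mul, zero_add]
        norm_cast
        omega
    · have hmod : v % p = v := Nat.mod_eq_of_lt (by omega)
      by_cases h0 : v = 0
      · simp [h0, show p ≠ 0 by omega]
      · simp only [hp, hmod, h0, if_false]
        simp only [ne_eq, ENat.natCast_ne_top, not_false_eq_true, not_true_eq_false, false_and,
          if_true, if_false]
        norm_cast
        omega

/-- For distinct variables `x_1, …, x_n` and `F_n = x_1 ⋄ (x_2 ⋄ (⋯ ⋄ x_n))`: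
`opt(F_n) = 2^n − 1`, and for `1 ≤ k ≤ 2^n` the lexicographically `k`-th largest
interpretation `I_k` over `x_1 > ⋯ > x_n` (containing `x_i` iff the `i`-th most
significant bit of the `n`-bit representation of `2^n − k` is `1`) satisfies
`deg(I_k, F_n) = k` if `k < 2^n` and `deg(I_k, F_n) = ∞` if `k = 2^n`. -/
theorem lcl_chain_lex (n : ℕ) (hn : 1 ≤ n) (x : ℕ → ℕ)
    (hx : ∀ i j, i < n → j < n → x i = x j → i = j) :
    (lchain x (n - 1)).opt = 2 ^ n - 1 ∧
      ∀ k : ℕ, 1 ≤ k → k ≤ 2 ^ n →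
        LF.deg {a | ∃ i, i < n ∧ a = x i ∧ (2 ^ n - k) / 2 ^ (n - 1 - i) % 2 = 1}
            (lchain x (n - 1))
          = if k < 2 ^ n then (k : ℕ∞) else ⊤ := by
  obtain ⟨n, rfl⟩ : ∃ m, n = m + 1 := ⟨n - 1, by omega⟩
  refine ⟨opt_lchain n x, fun k hk hk2 => ?_⟩
  rw [Nat.add_sub_cancel, deg_lchain _ n x (2 ^ (n + 1) - k) (by omega)]
  · by_cases h : k < 2 ^ (n + 1)
    · rw [if_pos h, if_neg (by omega), Nat.sub_sub_self hk2]
    · rw [if_neg h, if_pos (by omega)]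
  · intro i hi
    rw [Nat.testBit_eq_decide_div_mod_eq, decide_eq_true_iff]
    constructor
    · rintro ⟨j, hj, hij, hbit⟩
      rwa [hx i j (by omega) hj hij]
    · exact fun h => ⟨i, by omega, rfl, h⟩
end

section
/- In CCL, for distinct propositional variables a_1, …, a_n and every 1 ≤ i ≤ n, the interpretation {a_1, …, a_{n−i+1}} satisfies the right-nested ordered conjunction a_1 ⊙ (a_2 ⊙ (⋯ ⊙ a_n)) to degree exactly i, i.e. deg({a_1,…,a_{n−i+1}}, a_1 ⊙ (a_2 ⊙ (⋯ ⊙ a_n))) = i. -/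
open scoped Classical

/-- The right-nested ordered conjunction `x 0 ⊙ (x 1 ⊙ (⋯ ⊙ x n))`. -/
def cchain : (ℕ → ℕ) → ℕ → CF
  | x, 0 => CF.var (x 0)
  | x, n + 1 => (CF.var (x 0)).oc (cchain (fun j => x (j + 1)) n)

theorem opt_cchain (x : ℕ → ℕ) (n : ℕ) : (cchain x n).opt = n + 1 := by
  induction n generalizing x with
  | zero => rfl
  | succ n ih => rw [cchain, CF.opt, ih, CF.opt, Nat.add_comm]

theorem deg_cchain_eq_top {I : Set ℕ} {x : ℕ → ℕ} (h : x 0 ∉ I) (n : ℕ) :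
    (cchain x n).deg I = ⊤ := by
  cases n <;> simp [cchain, CF.deg, h]

/-- If exactly the first `k + 1` of the `k + d + 1` variables of the chain are true,
the chain has degree `d + 1`. -/
theorem deg_cchain_of_mem_iff {I : Set ℕ} {x : ℕ → ℕ} (k d : ℕ)
    (h : ∀ j ≤ k + d, x j ∈ I ↔ j ≤ k) : (cchain x (k + d)).deg I = (d + 1 : ℕ) := by
  have h0 : x 0 ∈ I := (h 0 (Nat.zero_le _)).2 (Nat.zero_le _)
  induction k generalizing x with
  | zero =>
    cases d with
    | zero => simp [cchain, CF.deg, h0]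
    | succ d =>
      have h1 : x (0 + 1) ∉ I := fun hmem => by
        have := (h (0 + 1) (by omega)).1 hmem
        omega
      have htop := deg_cchain_eq_top (x := fun j => x (j + 1)) h1 d
      rw [Nat.zero_add, cchain, CF.deg, htop, opt_cchain]
      simp only [CF.deg, h0, if_true]
      simp [add_comm]
  | succ k ih =>
    have htail : (cchain (fun j => x (j + 1)) (k + d)).deg I = (d + 1 : ℕ) := by
      refine ih (fun j hj => ?_) ((h 1 (by omega)).2 (by omega))
      rw [h (j + 1) (by omega)]
      omega
    rw [Nat.add_right_comm, cchain, CF.deg, htail, if_pos]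
    exact ⟨by simp [CF.deg, h0], ENat.natCast_ne_top _⟩

/-- For distinct variables `a_1, …, a_n` and `1 ≤ i ≤ n`, the interpretation
`{a_1, …, a_{n−i+1}}` satisfies `a_1 ⊙ (a_2 ⊙ (⋯ ⊙ a_n))` to degree exactly `i`. -/
theorem ccl_chain_degree (n : ℕ) (hn : 1 ≤ n) (x : ℕ → ℕ)
    (hx : ∀ i j, i < n → j < n → x i = x j → i = j)
    (i : ℕ) (hi1 : 1 ≤ i) (hi2 : i ≤ n) :
    CF.deg {a | ∃ j, j < n - i + 1 ∧ a = x j} (cchain x (n - 1)) = (i : ℕ∞) := by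
  obtain ⟨d, rfl⟩ := Nat.exists_eq_add_of_le' hi1
  obtain ⟨k, rfl⟩ := Nat.exists_eq_add_of_le' hi2
  have hlen : k + (d + 1) - (d + 1) = k := Nat.add_sub_cancel _ _
  rw [hlen]
  refine deg_cchain_of_mem_iff k d fun j hj => ⟨?_, fun hjk => ⟨j, by omega, rfl⟩⟩
  rintro ⟨l, hl, hjl⟩
  have := hx j l (by omega) (by omega) hjl
  omega
end
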